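/- The minimum wirelength of embedding the hypercube Q_n into the cycle C_{2^n} on 2^n vertices equals 3·2^{2n−3} − 2^{n−1}, for n ≥ 2, and this minimum is achieved by the reflected Gray code embedding ξ_n. -/

import Mathlib

open Finset

/-- Number of coordinates in which two 0-1 vectors differ. -/
def diffCount {n : ℕ} (u v : Fin n → Bool) : ℕ :=
  (Finset.univ.filter fun i => u i ≠ v i).card

/-- Adjacency in the hypercube `Q_n`: differ in exactly one coordinate. -/
def cubeAdj {n : ℕ} (u v : Fin n → Bool) : Prop := diffCount u v = 1

instance {n : ℕ} (u v : Fin n → Bool) : Decidable (cubeAdj u v) :=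
  inferInstanceAs (Decidable (diffCount u v = 1))

/-- `theta n S`: number of edges of `Q_n` with exactly one endpoint in `S`. -/
def theta (n : ℕ) (S : Finset (Fin n → Bool)) : ℕ :=
  ((Finset.univ ×ˢ Finset.univ).filter fun p : (Fin n → Bool) × (Fin n → Bool) =>
    p.1 ∈ S ∧ p.2 ∉ S ∧ cubeAdj p.1 p.2).card

/-- The reflected Gray code map `ξ_n : {0,1}^n → {1,...,2^n}`. -/
def gray : (n : ℕ) → (Fin n → Bool) → ℕ
  | 0, _ => 1
  | n + 1, v =>
    if v 0 = false then gray n (fun i => v i.succ)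
    else 2 ^ (n + 1) + 1 - gray n (fun i => v i.succ)

/-- Wirelength of an embedding `f` of `Q_n` into a host with distance `d`. -/
def wirelength {n : ℕ} {α : Type*} (d : α → α → ℕ) (f : (Fin n → Bool) → α) : ℕ :=
  (∑ u : Fin n → Bool, ∑ v : Fin n → Bool, if cubeAdj u v then d (f u) (f v) else 0) / 2

/-- Cyclic distance on the cycle with `m` vertices labeled `1,...,m`. -/
def cycDist (m a b : ℕ) : ℕ := min (Nat.dist a b) (m - Nat.dist a b)

/-- The 2-order Gray code map. -/
def gray2 (n₁ n₂ : ℕ) (v : Fin (n₁ + n₂) → Bool) : ℕ × ℕ :=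
  (gray n₁ fun i => v (Fin.castAdd n₂ i), gray n₂ fun i => v (Fin.natAdd n₁ i))

/-- The edge boundary of an initial segment of size `c` in `Q_L` (`c ≤ 2 ^ L`): the discrete
Takagi function. -/
def takagi : ℕ → ℕ → ℕ
  | 0, _ => 0
  | L + 1, c =>
    if c ≤ 2 ^ L then c + takagi L c else 2 ^ (L + 1) - c + takagi L (2 ^ (L + 1) - c)

theorem takagi_succ_of_le {L c : ℕ} (h : c ≤ 2 ^ L) : takagi (L + 1) c = c + takagi L c := by
  simp [takagi, h]

theorem takagi_zero_right (L : ℕ) : takagi L 0 = 0 := by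
  induction L with
  | zero => rfl
  | succ L ih => simp [takagi, ih]

theorem takagi_symm {L c : ℕ} (h : c ≤ 2 ^ L) : takagi L (2 ^ L - c) = takagi L c := by
  cases L with
  | zero => rfl
  | succ L =>
    have hp : 2 ^ (L + 1) = 2 ^ L + 2 ^ L := by ring
    rcases lt_trichotomy c (2 ^ L) with hc | hc | hc
    · rw [takagi, takagi, if_neg (by omega), if_pos (by omega)]
      congr 2 <;> omega
    · congr 1; omega
    · rw [takagi, takagi, if_pos (by omega), if_neg (by omega)]

theorem takagi_succ_of_ge {L c : ℕ} (h : 2 ^ L ≤ c) (h' : c ≤ 2 ^ (L + 1)) :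
    takagi (L + 1) c = 2 ^ (L + 1) - c + takagi L (2 ^ (L + 1) - c) := by
  rw [← takagi_symm h', takagi_succ_of_le]
  have hp : 2 ^ (L + 1) = 2 ^ L + 2 ^ L := by ring
  omega

theorem takagi_add_le {L : ℕ} : ∀ {a b : ℕ}, a ≤ b → a + b ≤ 2 ^ L →
    takagi L (a + b) + 2 * a ≤ takagi L a + takagi L b := by
  induction L with
  | zero =>
    intro a b hab h
    simp only [takagi]
    omega
  | succ L ih =>
    intro a b hab h
    have hp : 2 ^ (L + 1) = 2 ^ L + 2 ^ L := by ring
    have ha : a ≤ 2 ^ L := by omega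
    rw [takagi_succ_of_le ha]
    rcases le_total (a + b) (2 ^ L) with h1 | h1
    · rw [takagi_succ_of_le h1, takagi_succ_of_le (by omega)]
      have := ih hab h1
      omega
    rw [takagi_succ_of_ge h1 h]
    rcases le_total b (2 ^ L) with h2 | h2
    · rw [takagi_succ_of_le h2]
      have key := ih (a := 2 ^ L - b) (b := 2 ^ L - a) (by omega) (by omega)
      rw [takagi_symm ha, takagi_symm h2] at key
      rw [show 2 ^ (L + 1) - (a + b) = 2 ^ L - b + (2 ^ L - a) by omega]
      omega
    · rw [takagi_succ_of_ge h2 (by omega)]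
      have hs := takagi_symm (L := L) (c := 2 ^ (L + 1) - b) (by omega)
      have hd := takagi_symm (L := L) (c := 2 ^ (L + 1) - (a + b)) (by omega)
      have he : 2 ^ L - (2 ^ (L + 1) - (a + b)) = a + (2 ^ L - (2 ^ (L + 1) - b)) := by omega
      have key : takagi L (a + (2 ^ L - (2 ^ (L + 1) - b))) ≤
          takagi L a + takagi L (2 ^ L - (2 ^ (L + 1) - b)) := by
        rcases le_total a (2 ^ L - (2 ^ (L + 1) - b)) with h3 | h3
        · have := ih h3 (by omega)
          omega
        · have := ih h3 (by omega)
          rw [add_comm (2 ^ L - _) a] at this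
          omega
      rw [← he, hd, hs] at key
      omega

theorem takagi_succ_add_le {L a b : ℕ} (hab : a ≤ b) (hb : b ≤ 2 ^ L) :
    takagi (L + 1) (a + b) + 2 * a ≤ takagi L a + takagi L b + (a + b) := by
  have hp : 2 ^ (L + 1) = 2 ^ L + 2 ^ L := by ring
  rcases le_total (a + b) (2 ^ L) with h | h
  · rw [takagi_succ_of_le h]
    have := takagi_add_le hab h
    omega
  · rw [takagi_succ_of_ge h (by omega)]
    have := takagi_add_le (L := L) (a := 2 ^ L - b) (b := 2 ^ L - a) (by omega) (by omega)
    rw [takagi_symm hb, takagi_symm (hab.trans hb)] at this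
    rw [show 2 ^ (L + 1) - (a + b) = 2 ^ L - b + (2 ^ L - a) by omega]
    omega

theorem half_le_takagi {L c : ℕ} (hL : 1 ≤ L) (h1 : 2 ^ L ≤ 4 * c) (h2 : 2 * c ≤ 2 ^ L) :
    2 ^ L ≤ 2 * takagi L c := by
  obtain ⟨L, rfl⟩ := Nat.exists_eq_add_of_le' hL
  have hp : 2 ^ (L + 1) = 2 ^ L + 2 ^ L := by ring
  cases L with
  | zero =>
    obtain rfl : c = 1 := by omega
    decide
  | succ L =>
    have hp' : 2 ^ (L + 1) = 2 ^ L + 2 ^ L := by ring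
    rw [takagi_succ_of_le (by omega), takagi_succ_of_ge (by omega) (by omega)]
    omega

/-- Twice the trapezoidal sum of `takagi L` over `[0, m]`. -/
def trapezoid (L m : ℕ) : ℕ := ∑ j ∈ range m, (takagi L j + takagi L (j + 1))

theorem trapezoid_succ (L m : ℕ) :
    trapezoid L (m + 1) = trapezoid L m + (takagi L m + takagi L (m + 1)) :=
  sum_range_succ _ _

theorem trapezoid_mono (L : ℕ) : Monotone (trapezoid L) :=
  monotone_nat_of_le_succ fun m => by rw [trapezoid_succ]; omega

theorem trapezoid_succ_left {L m : ℕ} (h : m ≤ 2 ^ L) :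
    trapezoid (L + 1) m = m ^ 2 + trapezoid L m := by
  induction m with
  | zero => rfl
  | succ m ih =>
    rw [trapezoid_succ, trapezoid_succ, ih (by omega), takagi_succ_of_le h,
      takagi_succ_of_le (by omega)]
    ring

theorem trapezoid_symm {L m : ℕ} (h : m ≤ 2 ^ L) :
    trapezoid L (2 ^ L - m) + trapezoid L m = trapezoid L (2 ^ L) := by
  induction m with
  | zero => rfl
  | succ m ih =>
    rw [← ih (by omega), trapezoid_succ,
      show 2 ^ L - m = 2 ^ L - (m + 1) + 1 by omega, trapezoid_succ,
      takagi_symm h, show 2 ^ L - (m + 1) + 1 = 2 ^ L - m by omega, takagi_symm (by omega)]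
    ring

theorem trapezoid_two_pow (L : ℕ) : trapezoid L (2 ^ L) + 2 ^ L = (2 ^ L) ^ 2 := by
  induction L with
  | zero => rfl
  | succ L ih =>
    have hp : 2 ^ (L + 1) = 2 ^ L + 2 ^ L := by ring
    have hpos := Nat.two_pow_pos L
    have h := trapezoid_symm (L := L + 1) (m := 2 ^ L) (by omega)
    rw [show 2 ^ (L + 1) - 2 ^ L = 2 ^ L by omega, trapezoid_succ_left le_rfl] at h
    rw [← h, hp]
    linarith [ih]

theorem trapezoid_half {L : ℕ} : trapezoid (L + 1) (2 ^ L) + 2 ^ L = 2 * (2 ^ L) ^ 2 := by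
  rw [trapezoid_succ_left le_rfl]
  linarith [trapezoid_two_pow L]

theorem trapezoid_quarter_add {L s : ℕ} (h : s ≤ 2 ^ L) :
    trapezoid (L + 2) (2 ^ L + s) =
      trapezoid (L + 2) (2 ^ L) + s * 2 ^ (L + 2) + trapezoid L s := by
  have hp : 2 ^ (L + 1) = 2 ^ L + 2 ^ L := by ring
  have hp2 : 2 ^ (L + 2) = 2 ^ (L + 1) + 2 ^ (L + 1) := by ring
  have aux : ∀ t ≤ 2 ^ L, takagi (L + 2) (2 ^ L + t) = 2 ^ (L + 1) + takagi L t := by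
    intro t ht
    rw [takagi_succ_of_le (by omega), takagi_succ_of_ge (by omega) (by omega),
      show 2 ^ (L + 1) - (2 ^ L + t) = 2 ^ L - t by omega, takagi_symm ht]
    omega
  induction s with
  | zero => simp [trapezoid]
  | succ s ih =>
    rw [← add_assoc, trapezoid_succ, ih (by omega), trapezoid_succ, add_assoc (2 ^ L) s 1,
      aux _ h, aux _ (by omega), hp2]
    ring

/-- The mean of `takagi L` over an initial interval in the first half is at most
`(2 ^ L - 1) / 2`. -/
theorem trapezoid_add_le {L m : ℕ} (h : 2 * m ≤ 2 ^ L) :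
    trapezoid L m + m ≤ m * 2 ^ L := by
  induction L generalizing m with
  | zero =>
    obtain rfl : m = 0 := by omega
    simp [trapezoid]
  | succ L ih =>
    have hp : 2 ^ (L + 1) = 2 ^ L + 2 ^ L := by ring
    rcases le_total (2 * m) (2 ^ L) with h1 | h1
    · rw [trapezoid_succ_left (by omega)]
      nlinarith [ih h1]
    cases L with
    | zero =>
      obtain rfl : m = 1 := by omega
      decide
    | succ L =>
      have hp' : 2 ^ (L + 1) = 2 ^ L + 2 ^ L := by ring
      obtain ⟨s, rfl⟩ := Nat.exists_eq_add_of_le (show 2 ^ L ≤ m by omega)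
      have hs : s ≤ 2 ^ L := by omega
      rw [trapezoid_quarter_add hs, trapezoid_succ_left (by omega), trapezoid_succ_left le_rfl]
      have h3 := trapezoid_two_pow L
      have h4 := trapezoid_mono L hs
      rw [hp, hp']
      nlinarith

theorem trapezoid_le_mul_takagi {L m c : ℕ} (hmc : m ≤ c) (hc : 2 * c ≤ 2 ^ L) :
    trapezoid L m ≤ 2 * m * takagi L c := by
  induction L with
  | zero =>
    obtain rfl : m = 0 := by omega
    simp [trapezoid]
  | succ L ih =>
    have hp : 2 ^ (L + 1) = 2 ^ L + 2 ^ L := by ring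
    rcases le_total (2 * c) (2 ^ L) with h1 | h1
    · rw [trapezoid_succ_left (by omega), takagi_succ_of_le (by omega)]
      nlinarith [ih h1]
    · have h2 := half_le_takagi (L := L + 1) (by omega) (by omega) hc
      have h3 := trapezoid_add_le (L := L + 1) (m := m) (by omega)
      nlinarith

/-- The neighbour of `v` in direction `k`. -/
def flipBit {n : ℕ} (k : Fin n) (v : Fin n → Bool) : Fin n → Bool :=
  Function.update v k (!v k)

theorem flipBit_flipBit {n : ℕ} (k : Fin n) (v : Fin n → Bool) :
    flipBit k (flipBit k v) = v := by
  simp [flipBit]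

theorem flipBit_bijective {n : ℕ} (k : Fin n) : Function.Bijective (flipBit k) :=
  (show Function.Involutive (flipBit k) from flipBit_flipBit k).bijective

theorem flipBit_apply_self {n : ℕ} (k : Fin n) (v : Fin n → Bool) : flipBit k v k = !v k := by
  simp [flipBit]

theorem flipBit_apply_of_ne {n : ℕ} {j k : Fin n} (h : j ≠ k) (v : Fin n → Bool) :
    flipBit k v j = v j := by
  simp [flipBit, h]

theorem flipBit_insertNth_same {n : ℕ} (k : Fin (n + 1)) (b : Bool) (w : Fin n → Bool) :
    flipBit k (k.insertNth b w : Fin (n + 1) → Bool) = k.insertNth (!b) w := by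
  simp [flipBit, Fin.update_insertNth]

theorem flipBit_insertNth_succAbove {n : ℕ} (k : Fin (n + 1)) (j : Fin n) (b : Bool)
    (w : Fin n → Bool) :
    flipBit (k.succAbove j) (k.insertNth b w : Fin (n + 1) → Bool) =
      k.insertNth b (flipBit j w) := by
  simp [flipBit, Fin.insertNth_update]

theorem cubeAdj_iff {n : ℕ} (u v : Fin n → Bool) : cubeAdj u v ↔ ∃ k, flipBit k u = v := by
  rw [cubeAdj, diffCount, card_eq_one]
  refine exists_congr fun k => ?_
  constructor
  · intro h
    funext i
    have hi := congrArg (i ∈ ·) h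
    simp only [mem_filter, mem_univ, true_and, mem_singleton, eq_iff_iff] at hi
    by_cases hik : i = k
    · subst hik
      rw [flipBit_apply_self]
      revert hi
      cases u i <;> cases v i <;> simp
    · rw [flipBit_apply_of_ne hik]
      by_contra hne
      exact hik (hi.1 hne)
  · rintro rfl
    ext i
    by_cases hik : i = k
    · subst hik
      simp [flipBit_apply_self]
    · simp [flipBit_apply_of_ne hik, hik]

theorem flipBit_left_injective {n : ℕ} (u : Fin n → Bool) :
    Function.Injective fun k => flipBit k u := by
  intro j k h
  by_contra hjk
  have := congrFun h j
  simp [flipBit_apply_self, flipBit_apply_of_ne hjk] at this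

theorem sum_cubeAdj {n : ℕ} (F : (Fin n → Bool) → (Fin n → Bool) → ℕ) :
    (∑ u, ∑ v, if cubeAdj u v then F u v else 0) = ∑ k, ∑ u, F u (flipBit k u) := by
  rw [sum_comm (s := (univ : Finset (Fin n)))]
  refine sum_congr rfl fun u _ => ?_
  rw [← sum_filter, ← sum_image (f := F u) (g := fun k => flipBit k u)
    (flipBit_left_injective u).injOn]
  congr 1
  ext v
  simp [cubeAdj_iff]

theorem sum_insertNth {n : ℕ} {M : Type*} [AddCommMonoid M] (k : Fin (n + 1))
    (F : (Fin (n + 1) → Bool) → M) :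
    ∑ v, F v = ∑ w : Fin n → Bool, F (k.insertNth false w) +
      ∑ w : Fin n → Bool, F (k.insertNth true w) := by
  rw [← (Fin.insertNthEquiv (fun _ => Bool) k).sum_comp, Fintype.sum_prod_type, Fintype.sum_bool,
    add_comm]
  rfl

/-- Number of ordered pairs of adjacent vertices separated by `s` (twice its edge boundary). -/
def cutSize {n : ℕ} (s : (Fin n → Bool) → Bool) : ℕ :=
  ∑ k, ∑ v, if s v ≠ s (flipBit k v) then 1 else 0

theorem cutSize_insertNth {n : ℕ} (k : Fin (n + 1)) (s : (Fin (n + 1) → Bool) → Bool) :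
    cutSize s = cutSize (fun w => s (k.insertNth false w)) +
      cutSize (fun w => s (k.insertNth true w)) +
      2 * ∑ w : Fin n → Bool,
        if s (k.insertNth false w) ≠ s (k.insertNth true w) then 1 else 0 := by
  simp only [cutSize, Fin.sum_univ_succAbove _ k, sum_insertNth k, flipBit_insertNth_same,
    flipBit_insertNth_succAbove, sum_add_distrib, Bool.not_false, Bool.not_true]
  simp only [ne_comm (a := s (k.insertNth true _)) (b := s (k.insertNth false _))]
  ring

theorem abs_sum_sub_sum_le {n : ℕ} (s t : (Fin n → Bool) → Bool) :
    |((∑ w, (s w).toNat : ℕ) : ℤ) - (∑ w, (t w).toNat : ℕ)| ≤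
      (∑ w, if s w ≠ t w then 1 else 0 : ℕ) := by
  push_cast
  rw [← sum_sub_distrib]
  refine (abs_sum_le_sum_abs _ _).trans (sum_le_sum fun w _ => ?_)
  cases s w <;> cases t w <;> simp

theorem sum_toNat_le {n : ℕ} (s : (Fin n → Bool) → Bool) : ∑ w, (s w).toNat ≤ 2 ^ n := by
  refine (sum_le_card_nsmul univ _ 1 fun w _ => Bool.toNat_le _).trans ?_
  simp

/-- The edge-isoperimetric inequality in the hypercube. -/
theorem two_mul_takagi_le_cutSize {n : ℕ} (s : (Fin n → Bool) → Bool) :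
    2 * takagi n (∑ v, (s v).toNat) ≤ cutSize s := by
  induction n with
  | zero => simp [takagi]
  | succ n ih =>
    rw [cutSize_insertNth 0, sum_insertNth 0 fun v => (s v).toNat]
    have h0 := ih fun w => s ((0 : Fin (n + 1)).insertNth false w)
    have h1 := ih fun w => s ((0 : Fin (n + 1)).insertNth true w)
    have hd := abs_sum_sub_sum_le (fun w => s ((0 : Fin (n + 1)).insertNth false w))
      fun w => s ((0 : Fin (n + 1)).insertNth true w)
    have ha := sum_toNat_le fun w => s ((0 : Fin (n + 1)).insertNth false w)
    have hb := sum_toNat_le fun w => s ((0 : Fin (n + 1)).insertNth true w)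
    rw [abs_le] at hd
    set a := ∑ w : Fin n → Bool, (s ((0 : Fin (n + 1)).insertNth false w)).toNat
    set b := ∑ w : Fin n → Bool, (s ((0 : Fin (n + 1)).insertNth true w)).toNat
    rcases le_total a b with hab | hab
    · have := takagi_succ_add_le hab hb
      omega
    · have := takagi_succ_add_le hab ha
      rw [add_comm b a] at this
      omega

/-- `±1` encoding of a bit. -/
def boolSign (b : Bool) : ℤ := if b then 1 else -1

/-- Correlation of `s` with the `k`-th coordinate, normalised to `[-2 ^ (n - 2), 2 ^ (n - 2)]` when
`s` takes each value equally often. -/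
def bias {n : ℕ} (k : Fin n) (s : (Fin n → Bool) → Bool) : ℤ :=
  ∑ v, ((s v && v k).toNat : ℤ) - 2 ^ (n - 2)

/-- `s` takes each value equally often. -/
def IsBalanced {n : ℕ} (s : (Fin n → Bool) → Bool) : Prop :=
  2 * ∑ v, (s v).toNat = 2 ^ n

theorem sum_apply_toNat {n : ℕ} (k : Fin n) :
    2 * ∑ v : Fin n → Bool, (v k).toNat = 2 ^ n := by
  cases n with
  | zero => exact k.elim0
  | succ n =>
    rw [sum_insertNth k]
    simp [pow_succ, mul_comm]

theorem four_mul_bias {n : ℕ} (hn : 2 ≤ n) {s : (Fin n → Bool) → Bool} (hs : IsBalanced s)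
    (k : Fin n) : 4 * bias k s = ∑ v, boolSign (s v) * boolSign (v k) := by
  have hk := sum_apply_toNat k
  have h : ∀ v : Fin n → Bool, boolSign (s v) * boolSign (v k) =
      4 * ((s v && v k).toNat : ℤ) - 2 * (s v).toNat - 2 * (v k).toNat + 1 := by
    intro v
    cases s v <;> cases v k <;> simp [boolSign]
  obtain ⟨L, rfl⟩ := Nat.exists_eq_add_of_le' hn
  simp only [h, sum_add_distrib, sum_sub_distrib, ← mul_sum, bias]
  have hs' : (2 * ∑ v, ((s v).toNat : ℤ)) = 2 ^ (L + 2) := by exact_mod_cast hs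
  have hk' : (2 * ∑ v : Fin (L + 2) → Bool, ((v k).toNat : ℤ)) = 2 ^ (L + 2) := by
    exact_mod_cast hk
  rw [hs', hk']
  simp
  ring

theorem abs_bias_add_abs_bias_le {n : ℕ} (hn : 2 ≤ n) {s : (Fin n → Bool) → Bool}
    (hs : IsBalanced s) {j k : Fin n} (hjk : j ≠ k) : |bias j s| + |bias k s| ≤ 2 ^ (n - 2) := by
  have hj := four_mul_bias hn hs j
  have hk := four_mul_bias hn hs k
  have hflip : ∑ v : Fin n → Bool, |boolSign (v j) + boolSign (v k)| =
      ∑ v : Fin n → Bool, |boolSign (v j) - boolSign (v k)| := by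
    rw [← (flipBit_bijective k).sum_comp]
    refine sum_congr rfl fun v _ => ?_
    rw [flipBit_apply_of_ne hjk, flipBit_apply_self]
    cases v j <;> cases v k <;> simp [boolSign]
  have hsum : ∑ v : Fin n → Bool, |boolSign (v j) + boolSign (v k)| +
      ∑ v : Fin n → Bool, |boolSign (v j) - boolSign (v k)| = 2 * 2 ^ n := by
    rw [← sum_add_distrib, sum_congr rfl (g := fun _ => 2)]
    · simp [mul_comm]
    · intro v _
      cases v j <;> cases v k <;> simp [boolSign]
  have h1 : |4 * bias j s + 4 * bias k s| ≤
      ∑ v : Fin n → Bool, |boolSign (v j) + boolSign (v k)| := by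
    rw [hj, hk, ← sum_add_distrib]
    refine (abs_sum_le_sum_abs _ _).trans (sum_le_sum fun v _ => ?_)
    rw [← mul_add]
    cases s v <;> cases v j <;> cases v k <;> simp [boolSign]
  have h2 : |4 * bias j s - 4 * bias k s| ≤
      ∑ v : Fin n → Bool, |boolSign (v j) - boolSign (v k)| := by
    rw [hj, hk, ← sum_sub_distrib]
    refine (abs_sum_le_sum_abs _ _).trans (sum_le_sum fun v _ => ?_)
    rw [← mul_sub]
    cases s v <;> cases v j <;> cases v k <;> simp [boolSign]
  obtain ⟨L, rfl⟩ := Nat.exists_eq_add_of_le' hn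
  have hp : (2 : ℤ) ^ (L + 2) = 4 * 2 ^ L := by ring
  rw [Nat.add_sub_cancel]
  rw [abs_le] at h1 h2
  rcases abs_cases (bias j s) with h3 | h3 <;> rcases abs_cases (bias k s) with h4 | h4 <;> omega

theorem four_mul_abs_bias_le {n : ℕ} (hn : 2 ≤ n) {s : (Fin n → Bool) → Bool} (hs : IsBalanced s)
    (k : Fin n) : 4 * |bias k s| ≤ ∑ v, if s v ≠ s (flipBit k v) then 1 else 0 := by
  have h := four_mul_bias hn hs k
  have h' : ∑ v, boolSign (s v) * boolSign (v k) =
      -∑ v, boolSign (s (flipBit k v)) * boolSign (v k) := by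
    rw [← (flipBit_bijective k).sum_comp, ← sum_neg_distrib]
    refine sum_congr rfl fun v _ => ?_
    rw [flipBit_apply_self]
    cases v k <;> simp [boolSign]
  have h2 : 2 * (4 * bias k s) =
      ∑ v, (boolSign (s v) - boolSign (s (flipBit k v))) * boolSign (v k) := by
    simp only [sub_mul, sum_sub_distrib]
    linarith
  have h3 : |2 * (4 * bias k s)| ≤ 2 * ∑ v, if s v ≠ s (flipBit k v) then 1 else 0 := by
    rw [h2, mul_sum]
    refine (abs_sum_le_sum_abs _ _).trans (sum_le_sum fun v _ => ?_)
    cases s v <;> cases s (flipBit k v) <;> cases v k <;> simp [boolSign]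
  rw [abs_mul, abs_mul, abs_of_nonneg (by norm_num : (0 : ℤ) ≤ 2),
    abs_of_nonneg (by norm_num : (0 : ℤ) ≤ 4)] at h3
  linarith

theorem cutSize_ge_takagi_bias {L : ℕ} {s : (Fin (L + 2) → Bool) → Bool} (hs : IsBalanced s)
    (k : Fin (L + 2)) : 4 * 2 ^ L + 4 * takagi L (bias k s).natAbs ≤ cutSize s := by
  have hp : 2 ^ (L + 2) = 4 * 2 ^ L := by ring
  have hp' : 2 ^ (L + 1) = 2 * 2 ^ L := by ring
  rw [cutSize_insertNth k]
  have h0 := two_mul_takagi_le_cutSize fun w => s (k.insertNth false w)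
  have h1 := two_mul_takagi_le_cutSize fun w => s (k.insertNth true w)
  have hd := abs_sum_sub_sum_le (fun w => s (k.insertNth false w)) fun w => s (k.insertNth true w)
  have hb : bias k s = (∑ w, (s (k.insertNth true w)).toNat : ℕ) - 2 ^ L := by
    simp [bias, sum_insertNth k]
  rw [IsBalanced, sum_insertNth k, hp] at hs
  rw [abs_le] at hd
  set a := ∑ w : Fin (L + 1) → Bool, (s (k.insertNth false w)).toNat
  set b := ∑ w : Fin (L + 1) → Bool, (s (k.insertNth true w)).toNat
  have hcast : ((2 ^ L : ℕ) : ℤ) = 2 ^ L := by push_cast; rfl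
  have hab : takagi (L + 1) a = takagi (L + 1) b := by
    rw [← takagi_symm (c := b) (by omega)]
    congr 1
    omega
  have hbb : takagi (L + 1) b + (bias k s).natAbs = 2 ^ L + takagi L (bias k s).natAbs := by
    have hsym := takagi_symm (L := L) (c := (bias k s).natAbs) (by omega)
    rw [← hsym]
    rcases le_total b (2 ^ L) with h | h
    · rw [takagi_succ_of_le h, show 2 ^ L - (bias k s).natAbs = b by omega]
      omega
    · rw [takagi_succ_of_ge h (by omega),
        show 2 ^ L - (bias k s).natAbs = 2 ^ (L + 1) - b by omega]
      omega
  omega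

/-- Dirichlet energy of an integer-valued function on the hypercube. -/
def energy {n : ℕ} (h : (Fin n → Bool) → ℤ) : ℤ :=
  ∑ k, ∑ v, (h v - h (flipBit k v)) ^ 2

theorem energy_nonneg {n : ℕ} (h : (Fin n → Bool) → ℤ) : 0 ≤ energy h :=
  sum_nonneg fun _ _ => sum_nonneg fun _ _ => sq_nonneg _

theorem two_mul_energy_insertNth {n : ℕ} (h : (Fin (n + 1) → Bool) → ℤ) :
    2 * energy h =
      energy (fun w =>
        h ((0 : Fin (n + 1)).insertNth false w) + h ((0 : Fin (n + 1)).insertNth true w)) +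
      energy (fun w =>
        h ((0 : Fin (n + 1)).insertNth false w) - h ((0 : Fin (n + 1)).insertNth true w)) +
      4 * ∑ w : Fin n → Bool,
        (h ((0 : Fin (n + 1)).insertNth false w) - h ((0 : Fin (n + 1)).insertNth true w)) ^ 2 := by
  simp only [energy, Fin.sum_univ_succAbove _ (0 : Fin (n + 1)), sum_insertNth (0 : Fin (n + 1)),
    flipBit_insertNth_same, flipBit_insertNth_succAbove, Bool.not_false, Bool.not_true]
  simp only [mul_add, mul_sum, ← sum_add_distrib]
  rw [add_comm]
  congr 1
  · refine sum_congr rfl fun j _ => sum_congr rfl fun w _ => ?_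
    ring
  · refine sum_congr rfl fun w _ => ?_
    ring

theorem two_mul_sum_sq_insertNth {n : ℕ} (h : (Fin (n + 1) → Bool) → ℤ) :
    2 * ∑ v, h v ^ 2 =
      ∑ w : Fin n → Bool,
        (h ((0 : Fin (n + 1)).insertNth false w) + h ((0 : Fin (n + 1)).insertNth true w)) ^ 2 +
      ∑ w : Fin n → Bool,
        (h ((0 : Fin (n + 1)).insertNth false w) - h ((0 : Fin (n + 1)).insertNth true w)) ^ 2 := by
  rw [sum_insertNth 0, ← sum_add_distrib, ← sum_add_distrib, mul_sum]
  exact sum_congr rfl fun w _ => by ring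

/-- The Poincaré inequality on the hypercube. -/
theorem poincare {n : ℕ} (h : (Fin n → Bool) → ℤ) :
    4 * 2 ^ n * ∑ v, h v ^ 2 ≤ 2 ^ n * energy h + 4 * (∑ v, h v) ^ 2 := by
  induction n with
  | zero => simp [energy]
  | succ n ih =>
    have hE := two_mul_energy_insertNth h
    have hS := two_mul_sum_sq_insertNth h
    have hP := ih fun w =>
      h ((0 : Fin (n + 1)).insertNth false w) + h ((0 : Fin (n + 1)).insertNth true w)
    have hQ := energy_nonneg fun w =>
      h ((0 : Fin (n + 1)).insertNth false w) - h ((0 : Fin (n + 1)).insertNth true w)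
    rw [sum_insertNth 0 h, ← sum_add_distrib, pow_succ]
    have hN : (0 : ℤ) < 2 ^ n := by positivity
    have hQ' := mul_nonneg hN.le hQ
    linear_combination hP + hQ' + 2 ^ n * 4 * hS - 2 ^ n * hE

/-- The Poincaré inequality on the hypercube with the degree-one part removed. -/
theorem poincare_two {n : ℕ} (h : (Fin n → Bool) → ℤ) :
    8 * 2 ^ n * ∑ v, h v ^ 2 ≤ 2 ^ n * energy h + 8 * (∑ v, h v) ^ 2 +
      4 * ∑ k : Fin n, (∑ v, h v * boolSign (v k)) ^ 2 := by
  induction n with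
  | zero => simp [energy]
  | succ n ih =>
    have hE := two_mul_energy_insertNth h
    have hS := two_mul_sum_sq_insertNth h
    have hP := ih fun w =>
      h ((0 : Fin (n + 1)).insertNth false w) + h ((0 : Fin (n + 1)).insertNth true w)
    have hQ := poincare fun w =>
      h ((0 : Fin (n + 1)).insertNth false w) - h ((0 : Fin (n + 1)).insertNth true w)
    have h0 : (∑ v, h v * boolSign (v 0)) ^ 2 = (∑ w : Fin n → Bool,
        (h ((0 : Fin (n + 1)).insertNth false w) - h ((0 : Fin (n + 1)).insertNth true w))) ^ 2 := by
      rw [sum_insertNth 0, ← sum_add_distrib, sq_eq_sq_iff_eq_or_eq_neg]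
      right
      rw [← sum_neg_distrib]
      refine sum_congr rfl fun w _ => ?_
      simp only [Fin.insertNth_apply_same, boolSign]
      norm_num
      ring
    have hsucc : ∀ k : Fin n, ∑ v, h v * boolSign (v k.succ) = ∑ w : Fin n → Bool,
        (h ((0 : Fin (n + 1)).insertNth false w) + h ((0 : Fin (n + 1)).insertNth true w)) *
          boolSign (w k) := by
      intro k
      rw [sum_insertNth 0, ← sum_add_distrib]
      refine sum_congr rfl fun w _ => ?_
      rw [← Fin.succAbove_zero, Fin.insertNth_apply_succAbove, Fin.insertNth_apply_succAbove,
        add_mul]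
    rw [sum_insertNth 0 h, ← sum_add_distrib, pow_succ, Fin.sum_univ_succ, h0]
    simp only [hsucc]
    linear_combination hP + hQ + 2 ^ n * 8 * hS - 2 ^ n * hE

theorem six_mul_le_cutSize {L : ℕ} {s : (Fin (L + 2) → Bool) → Bool} (hs : IsBalanced s)
    (hb : ∀ k, 4 * |bias k s| ≤ 2 ^ L) : 6 * 2 ^ L ≤ cutSize s := by
  have hE : energy (fun v => boolSign (s v)) = 4 * (cutSize s : ℤ) := by
    simp only [energy, cutSize]
    push_cast
    simp only [mul_sum]
    refine sum_congr rfl fun k _ => sum_congr rfl fun v _ => ?_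
    cases s v <;> cases s (flipBit k v) <;> simp [boolSign]
  have hsq : ∑ v, boolSign (s v) ^ 2 = 4 * 2 ^ L := by
    rw [sum_congr rfl (g := fun _ => 1)]
    · simp
      ring
    · intro v _
      cases s v <;> simp [boolSign]
  have hzero : ∑ v, boolSign (s v) = 0 := by
    have h : ∀ v, boolSign (s v) = 2 * ((s v).toNat : ℤ) - 1 := by
      intro v
      cases s v <;> simp [boolSign]
    have hs' : (2 * ∑ v, ((s v).toNat : ℤ)) = 2 ^ (L + 2) := by exact_mod_cast hs
    simp only [h, sum_sub_distrib, ← mul_sum, hs']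
    simp
  have key := poincare_two fun v => boolSign (s v)
  simp only [← four_mul_bias (by omega : 2 ≤ L + 2) hs, hE, hsq, hzero] at key
  have hK : (0 : ℤ) < 2 ^ L := by positivity
  have h1 : 4 * ∑ k, (4 * bias k s) ^ 2 ≤ 4 * 2 ^ L * (cutSize s : ℤ) := by
    rw [cutSize]
    push_cast
    rw [mul_sum, mul_sum]
    refine sum_le_sum fun k _ => ?_
    have h2 := four_mul_abs_bias_le (by omega : 2 ≤ L + 2) hs k
    have h3 := hb k
    have h4 : (4 * |bias k s|) * (4 * |bias k s|) ≤
        2 ^ L * ∑ v, if s v ≠ s (flipBit k v) then 1 else 0 :=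
      mul_le_mul h3 h2 (by positivity) hK.le
    have h5 := sq_abs (bias k s)
    linarith
  rw [pow_add] at key
  have h4 : (2 : ℤ) ^ L * (32 * 2 ^ L) ≤ 2 ^ L * (5 * cutSize s) := by nlinarith
  have h5 := le_of_mul_le_mul_left h4 hK
  have : (6 * 2 ^ L : ℤ) ≤ cutSize s := by linarith
  exact_mod_cast this

/-- The contribution of bias `y` to the wirelength beyond its average. -/
def excess (L : ℕ) (y : ℤ) : ℤ :=
  if 2 ^ L < 2 * |y| then 2 * takagi L y.natAbs - (2 ^ L - 1) else 0

theorem excess_neg (L : ℕ) (y : ℤ) : excess L (-y) = excess L y := by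
  simp [excess]

theorem excess_of_le {L : ℕ} {y : ℤ} (h : 2 * |y| ≤ 2 ^ L) : excess L y = 0 :=
  if_neg h.not_gt

theorem sum_Ioc_succ (g : ℤ → ℤ) (M : ℕ) :
    ∑ y ∈ Ioc (-(M + 1 : ℕ) : ℤ) (M + 1 : ℕ), g y =
      ∑ y ∈ Ioc (-M : ℤ) M, g y + g (-M) + g (M + 1) := by
  have h : Ioc (-(M + 1 : ℕ) : ℤ) (M + 1 : ℕ) =
      insert (M + 1 : ℤ) (insert (-M : ℤ) (Ioc (-M : ℤ) M)) := by
    ext y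
    simp only [mem_Ioc, mem_insert]
    omega
  rw [h, sum_insert, sum_insert]
  · ring
  · simp
  · simp only [mem_Ioc, mem_insert]
    omega

theorem sum_excess_Ioc {L M : ℕ} (hL : 1 ≤ L) (h1 : 2 ^ L < 2 * M) (h2 : M ≤ 2 ^ L) :
    ∑ y ∈ Ioc (-M : ℤ) M, excess L y + 1 = 2 * trapezoid L M - 2 * M * (2 ^ L - 1) := by
  obtain ⟨L, rfl⟩ := Nat.exists_eq_add_of_le' hL
  have hp : 2 ^ (L + 1) = 2 * 2 ^ L := by ring
  have hpz : (2 : ℤ) ^ (L + 1) = 2 * (2 ^ L : ℕ) := by push_cast; ring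
  obtain ⟨t, rfl⟩ := Nat.exists_eq_add_of_le (show 2 ^ L + 1 ≤ M by omega)
  have hlarge : ∀ y : ℕ, 2 ^ L < y →
      excess (L + 1) y = 2 * takagi (L + 1) y - (2 ^ (L + 1) - 1) := by
    intro y hy
    rw [excess, if_pos (by rw [hpz, Nat.abs_cast]; omega), Int.natAbs_natCast]
  induction t with
  | zero =>
    have hz : ∑ y ∈ Ioc (-(2 ^ L : ℕ) : ℤ) (2 ^ L : ℕ), excess (L + 1) y = 0 := by
      refine sum_eq_zero fun y hy => excess_of_le ?_
      rw [mem_Ioc] at hy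
      have : |y| ≤ (2 ^ L : ℕ) := abs_le.2 ⟨hy.1.le, hy.2⟩
      omega
    have htop := hlarge (2 ^ L + 1) (by omega)
    rw [add_zero, sum_Ioc_succ, hz, excess_neg,
      excess_of_le (y := (2 ^ L : ℕ)) (by rw [hpz, Nat.abs_cast]), ← Nat.cast_succ,
      Nat.succ_eq_add_one, htop, trapezoid_succ]
    have ht := trapezoid_half (L := L)
    have hm : takagi (L + 1) (2 ^ L) = 2 ^ L := by
      have h0 := takagi_symm (L := L) (c := 0) (by omega)
      rw [takagi_succ_of_le le_rfl]
      rw [Nat.sub_zero, takagi_zero_right] at h0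
      omega
    rw [hm, hpz]
    zify at ht
    push_cast
    linear_combination -2 * ht
  | succ t ih =>
    have e : 2 ^ L + 1 + (t + 1) = 2 ^ L + 1 + t + 1 := rfl
    have htop := hlarge (2 ^ L + 1 + t + 1) (by omega)
    have hbot := hlarge (2 ^ L + 1 + t) (by omega)
    rw [e, sum_Ioc_succ, excess_neg, ← Nat.cast_succ, Nat.succ_eq_add_one, htop, hbot,
      trapezoid_succ]
    have := ih (by omega) (by omega)
    push_cast at this ⊢
    linear_combination this

theorem le_mul_excess {L m : ℕ} {y : ℤ} (hm : 2 * m ≤ 2 ^ L) (hy : y.natAbs + m ≤ 2 ^ L) :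
    (trapezoid L m : ℤ) - m * (2 ^ L - 1) ≤ m * excess L y := by
  rw [excess]
  split_ifs with h
  · have h' : 2 ^ L < 2 * y.natAbs := by
      zify
      exact h
    have key := trapezoid_le_mul_takagi (L := L) (m := m) (c := 2 ^ L - y.natAbs)
      (by omega) (by omega)
    rw [takagi_symm (by omega)] at key
    zify at key
    linarith
  · have key := trapezoid_add_le hm
    zify at key
    linarith

theorem sum_range_add_of_periodic {g : ℕ → ℤ} {P : ℕ} (hg : Function.Periodic g P) (a : ℕ) :
    ∑ i ∈ range P, g (a + i) = ∑ i ∈ range P, g i := by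
  induction a with
  | zero => simp
  | succ a ih =>
    rw [← ih]
    have h1 := sum_range_succ (fun i => g (a + i)) P
    have h2 := sum_range_succ' (fun i => g (a + i)) P
    have h3 := hg a
    simp only [add_zero, ← add_assoc, add_right_comm a _ 1] at h1 h2 h3 ⊢
    linarith

theorem exists_eq_of_step {b : ℕ → ℤ} (hstep : ∀ i, |b (i + 1) - b i| ≤ 1) {P : ℕ} {y : ℤ}
    (h0 : y ≤ b 0) (hP : b P < y) : ∃ i < P, b i = y := by
  classical
  have hex : ∃ i, b i < y := ⟨P, hP⟩
  have hpos : Nat.find hex ≠ 0 := by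
    intro h
    have := Nat.find_spec hex
    rw [h] at this
    omega
  obtain ⟨j, hj⟩ := Nat.exists_eq_succ_of_ne_zero hpos
  have hle := Nat.find_min' hex hP
  have h1 := Nat.find_spec hex
  have h2 := Nat.find_min hex (m := j) (by omega)
  rw [hj] at h1 hle
  have h3 := abs_le.1 (hstep j)
  rw [Nat.succ_eq_add_one] at h1
  exact ⟨j, by omega, by omega⟩

theorem sum_excess_of_max {L M : ℕ} (hL : 1 ≤ L) {b : ℕ → ℤ}
    (hstep : ∀ i, |b (i + 1) - b i| ≤ 1) (h0 : b 0 = M) (hP : b (2 * 2 ^ L) = -M)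
    (hmax : ∀ i, |b i| ≤ M) (h1 : 2 ^ L < 2 * M) (h2 : M ≤ 2 ^ L) :
    -1 ≤ ∑ i ∈ range (2 * 2 ^ L), excess L (b i) := by
  have hex : ∀ y ∈ Ioc (-M : ℤ) M, ∃ i < 2 * 2 ^ L, b i = y := by
    intro y hy
    rw [mem_Ioc] at hy
    exact exists_eq_of_step hstep (by omega) (by omega)
  choose! t ht hbt using hex
  have hinj : Set.InjOn t (Ioc (-M : ℤ) M : Finset ℤ) := by
    intro x hx y hy hxy
    rw [← hbt x hx, hxy, hbt y hy]
  set T := (Ioc (-M : ℤ) M).image t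
  have hT : T ⊆ range (2 * 2 ^ L) := by
    intro i hi
    obtain ⟨y, hy, rfl⟩ := mem_image.1 hi
    exact mem_range.2 (ht y hy)
  have hsumT : ∑ i ∈ T, excess L (b i) = ∑ y ∈ Ioc (-M : ℤ) M, excess L y := by
    rw [sum_image hinj]
    exact sum_congr rfl fun y hy => by rw [hbt y hy]
  obtain ⟨m, hm⟩ := Nat.exists_eq_add_of_le h2
  have hcard : (range (2 * 2 ^ L) \ T).card = 2 * m := by
    rw [card_sdiff_of_subset hT, card_image_of_injOn hinj, card_range, Int.card_Ioc]
    omega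
  have hrest : 2 * ((trapezoid L m : ℤ) - m * (2 ^ L - 1)) ≤
      ∑ i ∈ range (2 * 2 ^ L) \ T, excess L (b i) := by
    rcases Nat.eq_zero_or_pos m with rfl | hmpos
    · rw [card_eq_zero.1 hcard]
      simp [trapezoid]
    · have hmz : (0 : ℤ) < m := by exact_mod_cast hmpos
      refine le_of_mul_le_mul_left ?_ hmz
      rw [mul_sum]
      have := card_nsmul_le_sum (range (2 * 2 ^ L) \ T) (fun i => (m : ℤ) * excess L (b i)) _
        fun i _ => le_mul_excess (L := L) (m := m) (y := b i) (by omega)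
          (by have := abs_le.1 (hmax i); omega)
      rw [hcard, nsmul_eq_mul] at this
      push_cast at this
      linarith
  have hmain := sum_excess_Ioc hL h1 h2
  have hsym := trapezoid_symm (L := L) (m := m) (by omega)
  rw [show 2 ^ L - m = M by omega] at hsym
  have htot := trapezoid_two_pow L
  rw [← sum_sdiff hT, hsumT]
  zify at hsym htot hm
  rw [hm] at htot hrest hmain
  linarith

theorem sum_excess_ge {L : ℕ} (hL : 1 ≤ L) {b : ℕ → ℤ} (hstep : ∀ i, |b (i + 1) - b i| ≤ 1)
    (hanti : ∀ i, b (i + 2 * 2 ^ L) = -b i) (hbd : ∀ i, |b i| ≤ 2 ^ L) :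
    -1 ≤ ∑ i ∈ range (2 * 2 ^ L), excess L (b i) := by
  have hper : Function.Periodic (fun i => |b i|) (2 * 2 ^ L) := fun i => by simp [hanti]
  have hpos : 0 < 2 * 2 ^ L := by positivity
  obtain ⟨a, -, ha⟩ := exists_max_image (range (2 * 2 ^ L)) (fun i => |b i|)
    ⟨0, mem_range.2 hpos⟩
  have hmax : ∀ i, |b i| ≤ |b a| := by
    intro i
    rw [← hper.map_mod_nat i]
    exact ha _ (mem_range.2 (Nat.mod_lt _ hpos))
  rcases le_or_gt (2 * |b a|) (2 ^ L) with h | h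
  · rw [sum_eq_zero fun i _ => excess_of_le (by linarith [hmax i])]
    norm_num
  · have hperE : Function.Periodic (fun i => excess L (b i)) (2 * 2 ^ L) := fun i => by
      simp [hanti, excess_neg]
    rw [← sum_range_add_of_periodic hperE a]
    have hM : |b a| = ((b a).natAbs : ℕ) := Int.abs_eq_natAbs _
    have hb := hbd a
    have h1 : 2 ^ L < 2 * (b a).natAbs := by
      zify
      exact h
    have h2 : (b a).natAbs ≤ 2 ^ L := by
      zify
      exact hb
    rcases le_total 0 (b a) with hs | hs
    · exact sum_excess_of_max hL (M := (b a).natAbs) (b := fun i => b (a + i))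
        (fun i => hstep (a + i)) (by simp only [add_zero]; omega)
        (by simp only [hanti]; omega) (fun i => hM ▸ hmax _) h1 h2
    · have := sum_excess_of_max hL (M := (b a).natAbs) (b := fun i => -b (a + i))
        (fun i => by
          have := hstep (a + i)
          rw [← abs_neg] at this
          rwa [show -b (a + (i + 1)) - -b (a + i) = -(b (a + i + 1) - b (a + i)) by
            rw [add_assoc]; ring])
        (by simp only [add_zero]; omega)
        (by simp only [hanti]; omega) (fun i => by rw [abs_neg]; exact hM ▸ hmax _) h1 h2
      simpa only [excess_neg] using this

theorem exists_exit {K P : ℕ} (hP : 0 < P) {b : ℕ → ℤ} (hstep : ∀ i, |b (i + 1) - b i| ≤ 1)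
    (hanti : ∀ i, b (i + P) = -b i) (hK : 2 ≤ K) {a : ℕ} (ha : K < 2 * |b a|) :
    ∃ i < P, K < 2 * |b i| ∧ 2 * |b (i + 1)| ≤ K := by
  classical
  have hper : Function.Periodic (fun i => |b i|) P := fun i => by simp [hanti]
  have hex : ∃ j, 2 * |b (a + j)| ≤ K := by
    by_contra! hcon
    have hsign : ∀ j, 0 < b a * b (a + j) := by
      intro j
      induction j with
      | zero =>
        rw [add_zero]
        refine mul_self_pos.2 fun h => ?_
        rw [h, abs_zero] at ha
        omega
      | succ j ih =>
        have h1 := hcon j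
        have h2 := hcon (j + 1)
        have h3 := abs_le.1 (hstep (a + j))
        rw [← add_assoc] at h2 ⊢
        rcases mul_pos_iff.1 ih with h | h
        · refine mul_pos h.1 ?_
          rw [abs_of_pos h.2] at h1
          omega
        · refine mul_pos_of_neg_of_neg h.1 ?_
          rw [abs_of_neg h.2] at h1
          omega
    have := hsign P
    rw [hanti] at this
    nlinarith [mul_self_nonneg (b a)]
  obtain ⟨j, hj⟩ := Nat.exists_eq_succ_of_ne_zero (n := Nat.find hex) (fun h => by
    have := Nat.find_spec hex
    rw [h, add_zero] at this
    omega)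
  have h1 := Nat.find_spec hex
  have h2 := Nat.find_min hex (m := j) (by omega)
  rw [hj] at h1
  refine ⟨(a + j) % P, Nat.mod_lt _ hP, ?_, ?_⟩
  · have := hper.map_mod_nat (a + j)
    omega
  · have e1 := hper.map_mod_nat (a + j + 1)
    have e2 := hper.map_mod_nat ((a + j) % P + 1)
    rw [Nat.mod_add_mod] at e2
    rw [← e2, e1]
    exact h1

theorem sum_ge_of_bias {ι : Type*} [Fintype ι] {L : ℕ} (hL : 1 ≤ L) {b : ι → ℕ → ℤ}
    (hstep : ∀ k i, |b k (i + 1) - b k i| ≤ 1) (hanti : ∀ k i, b k (i + 2 * 2 ^ L) = -b k i)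
    (hbd : ∀ k i, |b k i| ≤ 2 ^ L) (hpair : ∀ j k i, j ≠ k → |b j i| + |b k i| ≤ 2 ^ L)
    {E : ℕ → ℤ} (hE : ∀ k i, 4 * (takagi L (b k i).natAbs : ℤ) ≤ E i)
    (hE' : ∀ i, (∀ k, 2 * |b k i| ≤ 2 ^ L) → 2 * 2 ^ L ≤ E i) :
    4 * (2 ^ L * (2 ^ L - 1)) ≤ ∑ i ∈ range (2 * 2 ^ L), E i := by
  classical
  have hpos : 0 < 2 * 2 ^ L := by positivity
  have heven : ∃ H : ℕ, 2 ^ L = 2 * H ∧ 1 ≤ H := by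
    obtain ⟨L, rfl⟩ := Nat.exists_eq_add_of_le' hL
    exact ⟨2 ^ L, by ring, Nat.one_le_two_pow⟩
  obtain ⟨H, hH, hH1⟩ := heven
  have hHz : (2 : ℤ) ^ L = 2 * H := by exact_mod_cast hH
  have hpoint : ∀ i, 2 * (2 ^ L - 1) + 2 * (∑ k, excess L (b k i) +
      if ∀ k, 2 * |b k i| ≤ 2 ^ L then 1 else 0) ≤ E i := by
    intro i
    split_ifs with h
    · rw [sum_eq_zero fun k _ => excess_of_le (h k)]
      have := hE' i h
      linarith
    · push Not at h
      obtain ⟨k, hk⟩ := h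
      rw [sum_eq_single k]
      · rw [excess, if_pos hk]
        have := hE k i
        linarith
      · intro j _ hjk
        refine excess_of_le ?_
        have := hpair j k i hjk
        linarith
      · simp
  set out := (range (2 * 2 ^ L)).filter fun i => ∀ k, 2 * |b k i| ≤ 2 ^ L
  set active : Finset ι := univ.filter fun k => ∃ i, 2 ^ L < 2 * |b k i|
  have hcard : active.card ≤ out.card := by
    have hex : ∀ k ∈ active, ∃ i < 2 * 2 ^ L, ((2 ^ L : ℕ) : ℤ) < 2 * |b k i| ∧
        2 * |b k (i + 1)| ≤ (2 ^ L : ℕ) := by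
      intro k hk
      obtain ⟨a, ha⟩ := (mem_filter.1 hk).2
      exact exists_exit hpos (hstep k) (hanti k) (by omega) (by exact_mod_cast ha)
    choose! t ht hin hout using hex
    refine card_le_card_of_injOn (fun k => (t k + 1) % (2 * 2 ^ L)) ?_ ?_
    · intro k hk
      refine mem_filter.2 ⟨mem_range.2 (Nat.mod_lt _ hpos), fun j => ?_⟩
      have hper : Function.Periodic (fun i => |b j i|) (2 * 2 ^ L) := fun i => by simp [hanti]
      have e := hper.map_mod_nat (t k + 1)
      rw [e]
      by_cases hjk : j = k
      · subst hjk
        exact_mod_cast hout j hk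
      · have h1 := hpair j k (t k) hjk
        have h2 := hin k hk
        have h3 := abs_abs_sub_abs_le (b j (t k + 1)) (b j (t k))
        have h4 := (abs_le.1 (h3.trans (hstep j (t k)))).2
        rw [hH] at h2
        rw [hHz] at h1 ⊢
        push_cast at h2
        omega
    · intro j hj k hk hjk
      have ej := ht j hj
      have ek := ht k hk
      have hmod : t j ≡ t k [MOD 2 * 2 ^ L] := Nat.ModEq.add_right_cancel' 1 hjk
      have htjk := hmod.eq_of_lt_of_lt ej ek
      by_contra hne
      have h1 := hin j hj
      have h2 := hin k hk
      have h3 := hpair j k (t j) hne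
      rw [← htjk] at h2
      push_cast at h1 h2
      linarith
  have hsum := sum_le_sum fun i (_ : i ∈ range (2 * 2 ^ L)) => hpoint i
  rw [sum_add_distrib, sum_const, card_range, nsmul_eq_mul, ← mul_sum, sum_add_distrib, sum_comm,
    sum_boole] at hsum
  have hact : -(active.card : ℤ) ≤ ∑ k, ∑ i ∈ range (2 * 2 ^ L), excess L (b k i) := by
    have : -(active.card : ℤ) = ∑ k, if ∃ i, 2 ^ L < 2 * |b k i| then (-1 : ℤ) else 0 := by
      rw [← sum_filter, sum_const, nsmul_eq_mul, mul_neg_one]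
    rw [this]
    refine sum_le_sum fun k _ => ?_
    split_ifs with h
    · exact sum_excess_ge hL (hstep k) (hanti k) (hbd k)
    · push Not at h
      exact (sum_eq_zero fun i _ => excess_of_le (h i)).ge
  push_cast at hsum
  have hc : (active.card : ℤ) ≤ out.card := by exact_mod_cast hcard
  linarith

/-- Indicator of the half `{x | x / H even}` of a cycle of length `2 * H`. -/
def halfCycle (H x : ℕ) : Bool := decide (x / H % 2 = 0)

theorem halfCycle_add {H : ℕ} (hH : 0 < H) (x : ℕ) : halfCycle H (x + H) = !halfCycle H x := by
  rw [halfCycle, halfCycle, Nat.add_div_right _ hH, ← decide_not, decide_eq_decide]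
  omega

theorem halfCycle_add_two_mul {H : ℕ} (hH : 0 < H) (x : ℕ) :
    halfCycle H (x + 2 * H) = halfCycle H x := by
  rw [two_mul, ← add_assoc, halfCycle_add hH, halfCycle_add hH, Bool.not_not]

theorem dvd_of_halfCycle_ne {H x : ℕ} (h : halfCycle H x ≠ halfCycle H (x + 1)) : H ∣ x + 1 := by
  by_contra hd
  exact h (by rw [halfCycle, halfCycle, Nat.succ_div_of_not_dvd hd])

theorem modEq_of_halfCycle {H x y : ℕ} (hx : halfCycle H x ≠ halfCycle H (x + 1))
    (hy : halfCycle H y ≠ halfCycle H (y + 1)) (hxy : halfCycle H (x + 1) = halfCycle H (y + 1)) :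
    x ≡ y [MOD 2 * H] := by
  obtain ⟨q, hq⟩ := dvd_of_halfCycle_ne hx
  obtain ⟨r, hr⟩ := dvd_of_halfCycle_ne hy
  have hH : 0 < H := Nat.pos_of_ne_zero fun h => by simp [h] at hq
  rw [halfCycle, halfCycle, hq, hr, Nat.mul_div_cancel_left _ hH, Nat.mul_div_cancel_left _ hH,
    decide_eq_decide] at hxy
  refine Nat.ModEq.add_right_cancel' 1 ?_
  rw [hq, hr, mul_comm 2 H]
  exact Nat.ModEq.mul_left' H (show q % 2 = r % 2 by omega)

/-- Number of the `H` antipodal cuts of the cycle of length `2 * H` that separate `a` and `b`. -/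
def cutCount (H a b : ℕ) : ℕ :=
  ∑ i ∈ range H, if halfCycle H (a + i) ≠ halfCycle H (b + i) then 1 else 0

theorem cutCount_comm (H a b : ℕ) : cutCount H a b = cutCount H b a := by
  simp only [cutCount, ne_comm]

theorem cutCount_triangle (H a b c : ℕ) : cutCount H a c ≤ cutCount H a b + cutCount H b c := by
  rw [cutCount, cutCount, cutCount, ← sum_add_distrib]
  refine sum_le_sum fun i _ => ?_
  cases halfCycle H (a + i) <;> cases halfCycle H (b + i) <;> cases halfCycle H (c + i) <;> simp

theorem cutCount_succ_le (H a : ℕ) : cutCount H a (a + 1) ≤ 1 := by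
  rw [cutCount, ← card_filter, card_le_one]
  intro i hi j hj
  simp only [mem_filter, mem_range, add_right_comm a 1] at hi hj
  have h := (Nat.modEq_zero_iff_dvd.2 (dvd_of_halfCycle_ne hi.2)).trans
    (Nat.modEq_zero_iff_dvd.2 (dvd_of_halfCycle_ne hj.2)).symm
  exact ((h.add_right_cancel' 1).add_left_cancel' a).eq_of_lt_of_lt hi.1 hj.1

theorem cutCount_add_le (H a d : ℕ) : cutCount H a (a + d) ≤ d := by
  induction d with
  | zero => simp [cutCount]
  | succ d ih =>
    have h1 := cutCount_triangle H a (a + d) (a + d + 1)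
    have h2 := cutCount_succ_le H (a + d)
    rw [← add_assoc]
    omega

theorem cycDist_comm (m a b : ℕ) : cycDist m a b = cycDist m b a := by
  rw [cycDist, cycDist, Nat.dist_comm]

theorem cutCount_le_cycDist {H a b : ℕ} (ha : a ≤ 2 * H) (hb : b ≤ 2 * H) :
    cutCount H a b ≤ cycDist (2 * H) a b := by
  wlog hab : a ≤ b generalizing a b
  · rw [cutCount_comm, cycDist_comm]
    exact this hb ha (le_of_not_ge hab)
  rcases Nat.eq_zero_or_pos H with rfl | hH
  · simp [cutCount]
  rw [cycDist, Nat.dist_eq_sub_of_le hab]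
  obtain ⟨d, rfl⟩ := Nat.exists_eq_add_of_le hab
  obtain ⟨e, he⟩ := Nat.exists_eq_add_of_le (show d ≤ 2 * H by omega)
  have h1 := cutCount_add_le H a d
  have h2 := cutCount_add_le H (a + d) e
  have h3 : cutCount H (a + d) (a + d + e) = cutCount H (a + d) a := by
    rw [add_assoc, ← he]
    simp only [cutCount, add_right_comm a (2 * H), halfCycle_add_two_mul hH]
  rw [h3, cutCount_comm] at h2
  omega

section Embedding

variable {L : ℕ} {f : (Fin (L + 2) → Bool) → ℕ}

theorem sum_comp_of_bijOn {n : ℕ} {f : (Fin n → Bool) → ℕ} {M : Type*} [AddCommMonoid M]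
    (hf : Set.BijOn f Set.univ (Set.Icc 1 (2 ^ n))) (F : ℕ → M) :
    ∑ v, F (f v) = ∑ p ∈ Icc 1 (2 ^ n), F p := by
  refine sum_bij (fun v _ => f v) ?_ ?_ ?_ fun _ _ => rfl
  · intro v _
    simpa using hf.mapsTo (Set.mem_univ v)
  · intro u _ v _ h
    exact hf.injOn (Set.mem_univ u) (Set.mem_univ v) h
  · intro p hp
    obtain ⟨v, -, hv⟩ := hf.surjOn (show p ∈ Set.Icc 1 (2 ^ n) by simpa using hp)
    exact ⟨v, mem_univ v, hv⟩

theorem isBalanced_halfCycle (hf : Set.BijOn f Set.univ (Set.Icc 1 (2 ^ (L + 2)))) (i : ℕ) :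
    IsBalanced fun v => halfCycle (2 ^ (L + 1)) (f v + i) := by
  have hH : 0 < 2 ^ (L + 1) := by positivity
  have hp : 2 ^ (L + 2) = 2 * 2 ^ (L + 1) := by ring
  have hconst : ∀ i, ∑ v, (halfCycle (2 ^ (L + 1)) (f v + i)).toNat =
      (2 ^ (L + 2)).count fun x => halfCycle (2 ^ (L + 1)) x = true := by
    intro i
    rw [sum_comp_of_bijOn hf fun p => (halfCycle (2 ^ (L + 1)) (p + i)).toNat,
      ← Nat.filter_Ico_card_eq_of_periodic (1 + i) (2 ^ (L + 2))
        (fun x => halfCycle (2 ^ (L + 1)) x = true), card_filter,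
      add_right_comm, ← sum_Ico_add', add_comm 1 (2 ^ (L + 2)), Finset.Ico_add_one_right_eq_Icc]
    · refine sum_congr rfl fun p _ => ?_
      cases halfCycle (2 ^ (L + 1)) (p + i) <;> rfl
    · intro x
      simp only [hp, halfCycle_add_two_mul hH]
  have h1 := hconst (i + 2 ^ (L + 1))
  have h0 := hconst i
  have hsum : ∑ v, (halfCycle (2 ^ (L + 1)) (f v + i)).toNat +
      ∑ v, (halfCycle (2 ^ (L + 1)) (f v + (i + 2 ^ (L + 1)))).toNat = 2 ^ (L + 2) := by
    rw [← sum_add_distrib, sum_congr rfl (g := fun _ => 1)]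
    · simp
    · intro v _
      rw [← add_assoc, halfCycle_add hH]
      cases halfCycle (2 ^ (L + 1)) (f v + i) <;> rfl
  rw [IsBalanced]
  omega

theorem bias_halfCycle_add (k : Fin (L + 2)) (i : ℕ) :
    bias k (fun v => halfCycle (2 ^ (L + 1)) (f v + (i + 2 * 2 ^ L))) =
      -bias k (fun v => halfCycle (2 ^ (L + 1)) (f v + i)) := by
  have hH : 0 < 2 ^ (L + 1) := by positivity
  have hk : 2 * ∑ v : Fin (L + 2) → Bool, ((v k).toNat : ℤ) = 2 ^ (L + 2) := by
    exact_mod_cast sum_apply_toNat k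
  have h : ∀ v, ((v k).toNat : ℤ) = ((halfCycle (2 ^ (L + 1)) (f v + i) && v k).toNat : ℤ) +
      ((halfCycle (2 ^ (L + 1)) (f v + (i + 2 * 2 ^ L)) && v k).toNat : ℤ) := by
    intro v
    rw [show 2 * 2 ^ L = 2 ^ (L + 1) by ring, ← add_assoc, halfCycle_add hH]
    cases halfCycle (2 ^ (L + 1)) (f v + i) <;> cases v k <;> rfl
  simp only [h, sum_add_distrib] at hk
  simp only [bias, Nat.add_sub_cancel]
  rw [show (2 : ℤ) ^ (L + 2) = 4 * 2 ^ L by ring] at hk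
  linarith

theorem card_flip_le_one (hf : Set.BijOn f Set.univ (Set.Icc 1 (2 ^ (L + 2)))) (i : ℕ) (b : Bool) :
    ∑ v, (if halfCycle (2 ^ (L + 1)) (f v + i) = !b ∧
      halfCycle (2 ^ (L + 1)) (f v + i + 1) = b then 1 else 0 : ℤ) ≤ 1 := by
  rw [sum_boole]
  norm_cast
  rw [card_le_one]
  intro u hu v hv
  simp only [mem_filter, mem_univ, true_and] at hu hv
  have hne : ∀ x : Bool, (!x) ≠ x := by decide
  have h := modEq_of_halfCycle (by rw [hu.1, hu.2]; exact hne b) (by rw [hv.1, hv.2]; exact hne b)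
    (by rw [hu.2, hv.2])
  have hu1 := hf.mapsTo (Set.mem_univ u)
  have hv1 := hf.mapsTo (Set.mem_univ v)
  rw [Set.mem_Icc, pow_succ' 2 (L + 1)] at hu1 hv1
  refine hf.injOn (Set.mem_univ u) (Set.mem_univ v) ?_
  have h' := h.add_right_cancel' i
  rw [← Nat.sub_add_cancel hu1.1, ← Nat.sub_add_cancel hv1.1] at h'
  have := (h'.add_right_cancel' 1).eq_of_lt_of_lt (by omega) (by omega)
  omega

theorem abs_bias_halfCycle_succ_sub_le (hf : Set.BijOn f Set.univ (Set.Icc 1 (2 ^ (L + 2))))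
    (k : Fin (L + 2)) (i : ℕ) :
    |bias k (fun v => halfCycle (2 ^ (L + 1)) (f v + (i + 1))) -
      bias k (fun v => halfCycle (2 ^ (L + 1)) (f v + i))| ≤ 1 := by
  simp only [bias, sub_sub_sub_cancel_right, ← sum_sub_distrib]
  rw [abs_le', ← sum_neg_distrib]
  constructor
  · refine (sum_le_sum fun v _ => ?_).trans (card_flip_le_one hf i true)
    rw [← add_assoc]
    cases halfCycle (2 ^ (L + 1)) (f v + i) <;>
      cases halfCycle (2 ^ (L + 1)) (f v + i + 1) <;> cases v k <;> simp
  · refine (sum_le_sum fun v _ => ?_).trans (card_flip_le_one hf i false)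
    rw [← add_assoc]
    cases halfCycle (2 ^ (L + 1)) (f v + i) <;>
      cases halfCycle (2 ^ (L + 1)) (f v + i + 1) <;> cases v k <;> simp

theorem sum_cutSize_le (hf : Set.BijOn f Set.univ (Set.Icc 1 (2 ^ (L + 2)))) :
    ∑ i ∈ range (2 * 2 ^ L), cutSize (fun v => halfCycle (2 ^ (L + 1)) (f v + i)) ≤
      ∑ k, ∑ u, cycDist (2 ^ (L + 2)) (f u) (f (flipBit k u)) := by
  simp only [cutSize]
  rw [sum_comm]
  refine sum_le_sum fun k _ => ?_
  rw [sum_comm]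
  refine sum_le_sum fun u _ => ?_
  rw [pow_succ' 2 (L + 1), ← pow_succ']
  have hu := hf.mapsTo (Set.mem_univ u)
  have hv := hf.mapsTo (Set.mem_univ (flipBit k u))
  rw [Set.mem_Icc, pow_succ' 2 (L + 1)] at hu hv
  exact cutCount_le_cycDist hu.2 hv.2

theorem abs_bias_le {s : (Fin (L + 2) → Bool) → Bool} (hs : IsBalanced s) (k : Fin (L + 2)) :
    |bias k s| ≤ 2 ^ L := by
  obtain ⟨j, hj⟩ := exists_ne k
  have := abs_bias_add_abs_bias_le (by omega) hs hj
  rw [Nat.add_sub_cancel] at this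
  linarith [abs_nonneg (bias j s)]

theorem sum_cutSize_ge (hf : Set.BijOn f Set.univ (Set.Icc 1 (2 ^ (L + 2)))) :
    12 * (2 ^ L) ^ 2 ≤
      ∑ i ∈ range (2 * 2 ^ L), cutSize (fun v => halfCycle (2 ^ (L + 1)) (f v + i)) + 4 * 2 ^ L := by
  rcases Nat.eq_zero_or_pos L with rfl | hL
  · have h : ∀ i, 4 ≤ cutSize (fun v => halfCycle (2 ^ (0 + 1)) (f v + i)) := fun i => by
      have := cutSize_ge_takagi_bias (isBalanced_halfCycle hf i) 0
      omega
    have h0 := h 0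
    have h1 := h 1
    simp only [pow_zero, mul_one, sum_range_succ, range_zero, sum_empty]
    omega
  · have hbal := isBalanced_halfCycle hf
    have key := sum_ge_of_bias hL
      (b := fun k i => bias k fun v => halfCycle (2 ^ (L + 1)) (f v + i))
      (E := fun i => (cutSize (fun v => halfCycle (2 ^ (L + 1)) (f v + i)) : ℤ) - 4 * 2 ^ L)
      (abs_bias_halfCycle_succ_sub_le hf) bias_halfCycle_add
      (fun k i => abs_bias_le (hbal i) k)
      (fun j k i hjk => abs_bias_add_abs_bias_le (by omega) (hbal i) hjk)
      (fun k i => by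
        have := cutSize_ge_takagi_bias (hbal i) k
        zify at this
        linarith)
      (fun i hi => by
        by_cases hsmall : ∀ k, 4 * |bias k fun v => halfCycle (2 ^ (L + 1)) (f v + i)| ≤ 2 ^ L
        · have := six_mul_le_cutSize (hbal i) hsmall
          zify at this
          linarith
        · push Not at hsmall
          obtain ⟨k, hk⟩ := hsmall
          have h1 := cutSize_ge_takagi_bias (hbal i) k
          have h2 := half_le_takagi hL
            (c := (bias k fun v => halfCycle (2 ^ (L + 1)) (f v + i)).natAbs)
            (by zify; exact hk.le) (by zify; exact hi k)
          zify at h1 h2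
          linarith)
    rw [sum_sub_distrib, sum_const, card_range, nsmul_eq_mul] at key
    zify
    push_cast at key
    linarith

end Embedding

theorem one_le_gray (n : ℕ) (v : Fin n → Bool) : 1 ≤ gray n v ∧ gray n v ≤ 2 ^ n := by
  induction n with
  | zero => simp [gray]
  | succ n ih =>
    have := ih fun i => v i.succ
    rw [gray, pow_succ]
    split_ifs <;> omega

theorem gray_insertNth_false {n : ℕ} (w : Fin n → Bool) :
    gray (n + 1) ((0 : Fin (n + 1)).insertNth false w : Fin (n + 1) → Bool) = gray n w := by
  simp [gray]

theorem gray_insertNth_true {n : ℕ} (w : Fin n → Bool) :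
    gray (n + 1) ((0 : Fin (n + 1)).insertNth true w : Fin (n + 1) → Bool) =
      2 ^ (n + 1) + 1 - gray n w := by
  simp [gray]

theorem gray_injective (n : ℕ) : Function.Injective (gray n) := by
  induction n with
  | zero => exact Function.injective_of_subsingleton _
  | succ n ih =>
    intro u v h
    have hu := one_le_gray n fun i => u i.succ
    have hv := one_le_gray n fun i => v i.succ
    rw [gray, gray, pow_succ] at h
    have key : u 0 = v 0 ∧ gray n (fun i => u i.succ) = gray n fun i => v i.succ := by
      cases h1 : u 0 <;> cases h2 : v 0 <;> simp only [h1, h2] at h <;> simp at h ⊢ <;> omega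
    funext i
    refine Fin.cases key.1 (fun i => congrFun (ih key.2) i) i

theorem gray_bijOn (n : ℕ) : Set.BijOn (gray n) Set.univ (Set.Icc 1 (2 ^ n)) := by
  have himg : univ.image (gray n) = Icc 1 (2 ^ n) := by
    refine eq_of_subset_of_card_le ?_ ?_
    · intro p hp
      obtain ⟨v, -, rfl⟩ := mem_image.1 hp
      exact mem_Icc.2 (one_le_gray n v)
    · rw [card_image_of_injective _ (gray_injective n)]
      simp
  have := (gray_injective n).injOn.bijOn_image (s := Set.univ)
  rwa [← coe_univ, ← coe_image, himg, coe_Icc, coe_univ] at this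

theorem sum_odd (M : ℕ) : ∑ p ∈ range M, (2 * p + 1) = M ^ 2 := by
  induction M with
  | zero => rfl
  | succ M ih =>
    rw [sum_range_succ, ih]
    ring

theorem sum_odd_reflect (M : ℕ) : ∑ p ∈ range M, (2 * M - 1 - 2 * p) = M ^ 2 := by
  rw [← sum_odd, ← sum_range_reflect]
  refine sum_congr rfl fun p hp => ?_
  rw [mem_range] at hp
  omega

theorem sum_gray {M : Type*} [AddCommMonoid M] (n : ℕ) (F : ℕ → M) :
    ∑ v, F (gray n v) = ∑ p ∈ range (2 ^ n), F (p + 1) := by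
  rw [sum_comp_of_bijOn (gray_bijOn n), ← Finset.Ico_add_one_right_eq_Icc, range_eq_Ico,
    sum_Ico_add', zero_add]

/-- Splitting a symmetric distance sum over the reflected Gray code into the two half-cubes. -/
theorem sum_gray_succ {n : ℕ} (d : ℕ → ℕ → ℕ) (hd : ∀ a b, d a b = d b a) :
    ∑ k, ∑ v, d (gray (n + 1) v) (gray (n + 1) (flipBit k v)) =
      2 * ∑ w, d (gray n w) (2 ^ (n + 1) + 1 - gray n w) +
      (∑ k, ∑ w, d (gray n w) (gray n (flipBit k w)) +
      ∑ k, ∑ w, d (2 ^ (n + 1) + 1 - gray n w) (2 ^ (n + 1) + 1 - gray n (flipBit k w))) := by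
  simp only [Fin.sum_univ_succAbove _ (0 : Fin (n + 1)), sum_insertNth (0 : Fin (n + 1)),
    flipBit_insertNth_same, flipBit_insertNth_succAbove, Bool.not_false, Bool.not_true,
    gray_insertNth_false, gray_insertNth_true, sum_add_distrib]
  simp only [hd (2 ^ (n + 1) + 1 - gray n _) (gray n _)]
  ring

theorem path_wirelength_gray (n : ℕ) :
    ∑ k, ∑ v, Nat.dist (gray n v) (gray n (flipBit k v)) + 2 ^ n = (2 ^ n) ^ 2 := by
  induction n with
  | zero => simp
  | succ n ih =>
    have hp : 2 ^ (n + 1) = 2 * 2 ^ n := by ring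
    rw [sum_gray_succ _ Nat.dist_comm,
      sum_gray n fun p => Nat.dist p (2 ^ (n + 1) + 1 - p)]
    have h1 : ∑ p ∈ range (2 ^ n), Nat.dist (p + 1) (2 ^ (n + 1) + 1 - (p + 1)) = (2 ^ n) ^ 2 := by
      rw [← sum_odd_reflect]
      refine sum_congr rfl fun p hp' => ?_
      rw [mem_range] at hp'
      rw [Nat.dist]
      omega
    have h2 : ∀ k : Fin n, ∀ w, Nat.dist (2 ^ (n + 1) + 1 - gray n w)
        (2 ^ (n + 1) + 1 - gray n (flipBit k w)) = Nat.dist (gray n w) (gray n (flipBit k w)) := by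
      intro k w
      have hw := one_le_gray n w
      have hw' := one_le_gray n (flipBit k w)
      simp only [Nat.dist]
      omega
    simp only [h1, h2]
    rw [hp]
    nlinarith [ih]

theorem cycle_wirelength_gray (L : ℕ) :
    ∑ k, ∑ v, cycDist (2 ^ (L + 2)) (gray (L + 2) v) (gray (L + 2) (flipBit k v)) + 4 * 2 ^ L =
      12 * (2 ^ L) ^ 2 := by
  have hp1 : 2 ^ (L + 1) = 2 * 2 ^ L := by ring
  have hp2 : 2 ^ (L + 2) = 4 * 2 ^ L := by ring
  rw [sum_gray_succ _ (cycDist_comm _),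
    sum_gray (L + 1) fun p => cycDist (2 ^ (L + 2)) p (2 ^ (L + 1 + 1) + 1 - p)]
  have h1 : ∑ p ∈ range (2 ^ (L + 1)),
      cycDist (2 ^ (L + 2)) (p + 1) (2 ^ (L + 1 + 1) + 1 - (p + 1)) = 2 * (2 ^ L) ^ 2 := by
    rw [hp1, two_mul (2 ^ L), sum_range_add, two_mul ((2 ^ L) ^ 2)]
    congr 1
    · rw [← sum_odd]
      refine sum_congr rfl fun p hp' => ?_
      rw [mem_range] at hp'
      simp only [cycDist, Nat.dist]
      omega
    · rw [← sum_odd_reflect]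
      refine sum_congr rfl fun p hp' => ?_
      rw [mem_range] at hp'
      simp only [cycDist, Nat.dist]
      omega
  have h2 : ∀ k : Fin (L + 1), ∀ w, cycDist (2 ^ (L + 2)) (gray (L + 1) w)
      (gray (L + 1) (flipBit k w)) = Nat.dist (gray (L + 1) w) (gray (L + 1) (flipBit k w)) := by
    intro k w
    have hw := one_le_gray (L + 1) w
    have hw' := one_le_gray (L + 1) (flipBit k w)
    simp only [cycDist, Nat.dist]
    omega
  have h3 : ∀ k : Fin (L + 1), ∀ w, cycDist (2 ^ (L + 2)) (2 ^ (L + 1 + 1) + 1 - gray (L + 1) w)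
      (2 ^ (L + 1 + 1) + 1 - gray (L + 1) (flipBit k w)) =
        Nat.dist (gray (L + 1) w) (gray (L + 1) (flipBit k w)) := by
    intro k w
    have hw := one_le_gray (L + 1) w
    have hw' := one_le_gray (L + 1) (flipBit k w)
    simp only [cycDist, Nat.dist]
    omega
  have h4 := path_wirelength_gray (L + 1)
  simp only [h1, h2, h3]
  rw [hp1] at h4
  nlinarith [h4]

theorem wirelength_eq {n : ℕ} {α : Type*} (d : α → α → ℕ) (f : (Fin n → Bool) → α) :
    wirelength d f = (∑ k, ∑ u, d (f u) (f (flipBit k u))) / 2 := by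
  rw [wirelength, sum_cubeAdj fun u v => d (f u) (f v)]

/-- Minimum wirelength of the hypercube into the cycle `C_{2^n}`, achieved by Gray code. -/
theorem stmt8 (n : ℕ) (hn : 2 ≤ n) :
    (∀ f : (Fin n → Bool) → ℕ, Set.BijOn f Set.univ (Set.Icc 1 (2 ^ n)) →
      3 * 2 ^ (2 * n - 3) - 2 ^ (n - 1) ≤ wirelength (cycDist (2 ^ n)) f) ∧
    Set.BijOn (gray n) Set.univ (Set.Icc 1 (2 ^ n)) ∧
    wirelength (cycDist (2 ^ n)) (gray n) = 3 * 2 ^ (2 * n - 3) - 2 ^ (n - 1) := by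
  obtain ⟨L, rfl⟩ := Nat.exists_eq_add_of_le' hn
  have h1 : 3 * 2 ^ (2 * (L + 2) - 3) = 6 * (2 ^ L) ^ 2 := by
    rw [show 2 * (L + 2) - 3 = L + L + 1 by omega, pow_succ, pow_add]
    ring
  have h2 : 2 ^ (L + 2 - 1) = 2 * 2 ^ L := by
    rw [show L + 2 - 1 = L + 1 by omega, pow_succ']
  rw [h1, h2]
  refine ⟨fun f hf => ?_, gray_bijOn _, ?_⟩
  · rw [wirelength_eq]
    have h3 := sum_cutSize_le hf
    have h4 := sum_cutSize_ge hf
    omega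
  · rw [wirelength_eq]
    have h3 := cycle_wirelength_gray L
    omega
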